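/- If G is a finite nontrivial group, then the geometric realization of the nerve of the poset of all cosets gN, where N ranges over the proper normal subgroups of G, ordered by inclusion, is not contractible. -/

import Mathlib

open scoped Pointwise

/-- The coset poset associated with a family `F` of subgroups of `G`: the set of
all cosets `g • H` with `g ∈ G` and `H ∈ F`, partially ordered by inclusion. -/
def CosetPoset (G : Type) [Group G] (F : Set (Subgroup G)) : Type _ :=
  {X : Set G // ∃ H ∈ F, ∃ g : G, X = g • (H : Set G)}

instance {G : Type} [Group G] {F : Set (Subgroup G)} : PartialOrder (CosetPoset G F) :=
  Subtype.partialOrder _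

/-- The geometric realization of the nerve of the coset poset of the family `F`. -/
noncomputable def cosetNerveRealization (G : Type) [Group G] (F : Set (Subgroup G)) : TopCat :=
  SSet.toTop.obj (CategoryTheory.nerve (CosetPoset G F))

section NoRetraction

open MeasureTheory Metric Set
open scoped NNReal

variable {E : Type*} [NormedAddCommGroup E] [NormedSpace ℝ E] [FiniteDimensional ℝ E]

/-- The value of `t ↦ det (1 + t A)` at `1` is an affine combination, with coefficients independent
of `A`, of its values at arbitrarily small positive times. -/
theorem exists_det_one_add_eq_sum (E : Type*) [NormedAddCommGroup E] [NormedSpace ℝ E]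
    [FiniteDimensional ℝ E] {ε : ℝ} (hε : 0 < ε) :
    ∃ (s : Finset ℕ) (c t : ℕ → ℝ), (∀ j, 0 < t j ∧ t j < ε) ∧ ∑ j ∈ s, c j = 1 ∧
      ∀ A : E →L[ℝ] E, (1 + A).det = ∑ j ∈ s, c j * (1 + t j • A).det := by
  classical
  set t : ℕ → ℝ := fun j => ε / (j + 2) with ht
  set s := Finset.range (Module.finrank ℝ E + 1) with hs
  have hinj : Set.InjOn t s := by
    intro i _ j _ hij
    have h1 : (0 : ℝ) < i + 2 := by positivity
    have h2 : (0 : ℝ) < j + 2 := by positivity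
    simp only [ht] at hij
    rw [div_eq_div_iff h1.ne' h2.ne'] at hij
    have := mul_left_cancel₀ hε.ne' hij
    exact_mod_cast (by linarith : (i : ℝ) = j)
  refine ⟨s, fun j => (Lagrange.basis s t j).eval 1, t, fun j => ⟨by positivity, ?_⟩, ?_, ?_⟩
  · have h1 : (0 : ℝ) ≤ j := by positivity
    rw [ht, div_lt_iff₀ (by positivity)]
    nlinarith
  · rw [← Polynomial.eval_finsetSum, Lagrange.sum_basis hinj ⟨0, by simp [hs]⟩, Polynomial.eval_one]
  · intro A
    let b := Module.finBasis ℝ E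
    let M := LinearMap.toMatrix b b (A : E →ₗ[ℝ] E)
    let p : Polynomial ℝ := Matrix.det
      ((Polynomial.X : Polynomial ℝ) • M.map Polynomial.C + (1 : Matrix _ _ ℝ).map Polynomial.C)
    have hp (r : ℝ) : p.eval r = (1 + r • A).det := by
      have h1 : (1 + r • A).det = (1 + r • M).det := by
        rw [ContinuousLinearMap.det, ← LinearMap.det_toMatrix b]
        congr 1
        change LinearMap.toMatrix b b (LinearMap.id + r • (A : E →ₗ[ℝ] E)) = _
        rw [map_add, map_smul, LinearMap.toMatrix_id]
      rw [h1, ← Polynomial.coe_evalRingHom, RingHom.map_det]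
      congr 1
      ext i j
      simp [Matrix.one_apply, add_comm, apply_ite, mul_comm r]
    have hdeg : p.degree < s.card := by
      refine Polynomial.degree_le_natDegree.trans_lt ?_
      have := Polynomial.natDegree_det_X_add_C_le M 1
      rw [Fintype.card_fin] at this
      rw [hs, Finset.card_range]
      exact_mod_cast Nat.lt_succ_of_le this
    have := Lagrange.eq_interpolate hinj hdeg
    have h1 := hp 1
    rw [one_smul] at h1
    rw [← h1, this, Lagrange.interpolate_apply, Polynomial.eval_finsetSum]
    refine Finset.sum_congr rfl fun j _ => ?_
    simp [hp, mul_comm]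

theorem bijective_id_add_of_lipschitzWith {g : E → E} {K : ℝ≥0} (hg : LipschitzWith K g)
    (hK : K < 1) : Function.Bijective fun x => x + g x := by
  have h : ApproximatesLinearOn (fun x => x + g x)
      ((ContinuousLinearEquiv.refl ℝ E : E ≃L[ℝ] E) : E →L[ℝ] E) univ K := by
    intro x _ y _
    have := hg.dist_le_mul x y
    rw [dist_eq_norm, dist_eq_norm] at this
    have h : x + g x - (y + g y) - (x - y) = g x - g y := by abel
    rw [← h] at this
    exact this
  have hc : Subsingleton E ∨
      K < ‖((ContinuousLinearEquiv.refl ℝ E).symm : E →L[ℝ] E)‖₊⁻¹ := by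
    rcases subsingleton_or_nontrivial E with hE | hE
    · exact Or.inl hE
    · right
      have : ‖((ContinuousLinearEquiv.refl ℝ E).symm : E →L[ℝ] E)‖₊ = 1 := by
        ext
        exact ContinuousLinearMap.norm_id
      simpa [this] using hK
  exact ⟨injOn_univ.1 (h.injOn hc), h.surjective hc⟩

theorem image_ball_id_add_of_lipschitzWith {g : E → E} {K : ℝ≥0} (hg : LipschitzWith K g)
    (hK : K < 1) (h0 : ∀ x, 1 ≤ ‖x‖ → g x = 0) :
    (fun x => x + g x) '' ball 0 1 = ball 0 1 := by
  obtain ⟨hinj, hsurj⟩ := bijective_id_add_of_lipschitzWith hg hK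
  ext y
  constructor
  · rintro ⟨x, hx, rfl⟩
    by_contra hy
    have hy' : 1 ≤ ‖x + g x‖ := by simpa using hy
    have : x + g x = x := hinj (by simp [h0 _ hy'])
    exact hy (this.symm ▸ hx : x + g x ∈ ball 0 1)
  · intro hy
    obtain ⟨x, rfl⟩ := hsurj y
    refine ⟨x, ?_, rfl⟩
    by_contra hx
    have hx' : 1 ≤ ‖x‖ := by simpa using hx
    simp only [h0 _ hx', add_zero] at hy
    exact hx hy

theorem exists_fderiv_id_add_det_ne_zero [MeasurableSpace E] [BorelSpace E] {g : E → E} {K : ℝ≥0}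
    (hg : LipschitzWith K g) (h0 : ∀ x, 1 ≤ ‖x‖ → g x = 0)
    (hd : ∀ x ∈ ball (0 : E) 1, DifferentiableAt ℝ g x) :
    ∃ x ∈ ball (0 : E) 1, (1 + fderiv ℝ g x).det ≠ 0 := by
  by_contra! hdet
  let μ : Measure E := Measure.addHaar
  have hcont : ContinuousAt (fun A : E →L[ℝ] E => A.det) 1 :=
    ContinuousLinearMap.continuous_det.continuousAt
  have hpos : ∀ᶠ A in nhds (1 : E →L[ℝ] E), 0 < A.det := by
    refine hcont.eventually (lt_mem_nhds ?_)
    simp [ContinuousLinearMap.det]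
  obtain ⟨δ, hδ, hball⟩ := Metric.eventually_nhds_iff.1 hpos
  set ε : ℝ := min δ 1 / (K + 1) with hε
  have hK : (0 : ℝ) ≤ K := K.2
  have hεpos : 0 < ε := by positivity
  have key (t : ℝ) (ht0 : 0 < t) (ht : t < ε) :
      IntegrableOn (fun x => (1 + t • fderiv ℝ g x).det) (ball 0 1) μ ∧
      ∫ x in ball 0 1, (1 + t • fderiv ℝ g x).det ∂μ = μ.real (ball 0 1) := by
    have htK : t * (K + 1) < min δ 1 := (lt_div_iff₀ (by positivity)).1 ht
    have htK1 : t * K < 1 := by linarith [min_le_right δ 1]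
    have htKδ : t * K < δ := by linarith [min_le_left δ 1]
    have hlip : LipschitzWith (t.toNNReal * K) (fun x => t • g x) := by
      refine LipschitzWith.of_dist_le_mul fun x y => ?_
      rw [dist_smul₀, Real.norm_of_nonneg ht0.le, NNReal.coe_mul, Real.coe_toNNReal _ ht0.le, mul_assoc]
      exact mul_le_mul_of_nonneg_left (hg.dist_le_mul x y) ht0.le
    have hlt : t.toNNReal * K < 1 := by
      rw [← NNReal.coe_lt_coe, NNReal.coe_mul, Real.coe_toNNReal _ ht0.le]
      exact htK1
    have hdpos (x : E) : 0 < (1 + t • fderiv ℝ g x).det := by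
      refine hball ?_
      rw [dist_eq_norm, add_sub_cancel_left, norm_smul, Real.norm_of_nonneg ht0.le]
      exact (mul_le_mul_of_nonneg_left (norm_fderiv_le_of_lipschitz ℝ hg) ht0.le).trans_lt htKδ
    have himg := image_ball_id_add_of_lipschitzWith hlip hlt (fun x hx => by simp [h0 x hx])
    have hinj := (bijective_id_add_of_lipschitzWith hlip hlt).1.injOn (s := ball 0 1)
    have hder (x : E) (hx : x ∈ ball (0 : E) 1) : HasFDerivWithinAt (fun x => x + t • g x)
        (1 + t • fderiv ℝ g x) (ball 0 1) x :=
      ((hasFDerivAt_id x).add ((hd x hx).hasFDerivAt.const_smul t)).hasFDerivWithinAt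
    have h1 := integrableOn_image_iff_integrableOn_abs_det_fderiv_smul μ measurableSet_ball hder hinj
      (fun _ => (1 : ℝ))
    have h2 := integral_image_eq_integral_abs_det_fderiv_smul μ measurableSet_ball hder hinj
      (fun _ => (1 : ℝ))
    simp only [himg, abs_of_pos (hdpos _), smul_eq_mul, mul_one] at h1 h2
    refine ⟨h1.1 ?_, ?_⟩
    · exact integrableOn_const measure_ball_lt_top.ne
    · exact h2.symm.trans (by rw [setIntegral_const, smul_eq_mul, mul_one])
  obtain ⟨s, c, t, ht, hc, hsum⟩ := exists_det_one_add_eq_sum E hεpos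
  have : ∫ x in ball 0 1, (1 + fderiv ℝ g x).det ∂μ = μ.real (ball 0 1) := by
    refine integral_congr_ae (Filter.Eventually.of_forall fun x => hsum _) |>.trans ?_
    rw [integral_finsetSum _ fun j _ => (key _ (ht j).1 (ht j).2).1.const_mul _]
    simp_rw [integral_const_mul, (key _ (ht _).1 (ht _).2).2]
    rw [← Finset.sum_mul, hc, one_mul]
  rw [setIntegral_congr_fun measurableSet_ball (g := fun _ => (0 : ℝ)) (fun x hx => hdet x hx)] at this
  have hpos : 0 < μ.real (ball (0 : E) 1) :=
    ENNReal.toReal_pos (measure_ball_pos μ _ one_pos).ne' measure_ball_lt_top.ne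
  rw [integral_zero] at this
  exact hpos.ne this

end NoRetraction

section Brouwer

open MeasureTheory Metric Set
open scoped NNReal

theorem lipschitzWith_indicator_closedBall {E F : Type*} [NormedAddCommGroup E] [NormedSpace ℝ E]
    [NormedAddCommGroup F] {g : E → F} {K : ℝ≥0} (hg : LipschitzOnWith K g (closedBall 0 1))
    (h0 : ∀ x, ‖x‖ = 1 → g x = 0) : LipschitzWith K (indicator (closedBall 0 1) g) := by
  have key (x y : E) (hx : x ∈ closedBall (0 : E) 1) (hy : y ∉ closedBall (0 : E) 1) :
      dist (indicator (closedBall 0 1) g x) (indicator (closedBall 0 1) g y) ≤ K * dist x y := by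
    have hc : ContinuousOn (fun s : ℝ => ‖AffineMap.lineMap x y s‖) (Icc 0 1) := by
      have : Continuous (fun s : ℝ => AffineMap.lineMap x y s) := AffineMap.lineMap_continuous
      exact this.norm.continuousOn
    obtain ⟨s, hs, hs1⟩ := intermediate_value_Icc (zero_le_one (α := ℝ)) hc
      (show (1 : ℝ) ∈ _ by simp at hx hy; simp [hx, hy.le])
    set z : E := AffineMap.lineMap x y s
    have hz : ‖z‖ = 1 := hs1
    have hxz : dist x z ≤ dist x y := by
      rw [dist_left_lineMap, Real.norm_of_nonneg hs.1]
      exact mul_le_of_le_one_left dist_nonneg hs.2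
    rw [indicator_of_mem hx, indicator_of_notMem hy, ← h0 z hz]
    exact (hg.dist_le_mul x hx z (by simp [hz])).trans
      (mul_le_mul_of_nonneg_left hxz K.2)
  refine LipschitzWith.of_dist_le_mul fun x y => ?_
  by_cases hx : x ∈ closedBall (0 : E) 1 <;> by_cases hy : y ∈ closedBall (0 : E) 1
  · rw [indicator_of_mem hx, indicator_of_mem hy]
    exact hg.dist_le_mul x hx y hy
  · exact key x y hx hy
  · rw [dist_comm, dist_comm x]
    exact key y x hy hx
  · rw [indicator_of_notMem hx, indicator_of_notMem hy, dist_self]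
    positivity

variable {E : Type*} [NormedAddCommGroup E] [InnerProductSpace ℝ E] [FiniteDimensional ℝ E]

theorem det_eq_zero_of_norm_eq_one {r : E → E} {r' : E →L[ℝ] E} {x : E} (hr : HasFDerivAt r r' x)
    (h1 : ∀ᶠ y in nhds x, ‖r y‖ = 1) : r'.det = 0 := by
  by_contra hdet
  have hc : HasFDerivAt (fun y => inner ℝ (r y) (r y)) (0 : E →L[ℝ] ℝ) x := by
    refine (hasFDerivAt_const (1 : ℝ) x).congr_of_eventuallyEq ?_
    filter_upwards [h1] with y hy
    rw [real_inner_self_eq_norm_sq, hy, one_pow]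
  have h2 := (hr.inner ℝ hr).unique hc
  have hsurj : Function.Surjective r' := by
    exact (LinearMap.equivOfDetNeZero (r' : E →ₗ[ℝ] E) hdet).surjective
  obtain ⟨h, hh⟩ := hsurj (r x)
  have h3 := DFunLike.congr_fun h2 h
  simp [hh, h1.self_of_nhds] at h3

theorem exists_fixedPoint_of_contDiff {p : E → E} (hp : ContDiff ℝ 1 p) (hp1 : ∀ x, ‖p x‖ < 1) :
    ∃ x, ‖x‖ ≤ 1 ∧ p x = x := by
  by_contra! hfix
  let _ : MeasurableSpace E := borel E
  have _ : BorelSpace E := ⟨rfl⟩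
  let v : E → E := fun x => x - p x
  let D : E → ℝ := fun x => inner ℝ x (v x) ^ 2 + ‖v x‖ ^ 2 * (1 - ‖x‖ ^ 2)
  let l : E → ℝ := fun x => (-inner ℝ x (v x) + √(D x)) / ‖v x‖ ^ 2
  let g : E → E := fun x => l x • v x
  have hv (x : E) (hx : ‖x‖ ≤ 1) : 0 < ‖v x‖ ^ 2 := by
    have : v x ≠ 0 := sub_ne_zero.2 (hfix x hx).symm
    positivity
  have hinner (x : E) (hx : ‖x‖ = 1) : 0 < inner ℝ x (v x) := by
    have h1 : inner ℝ x (v x) = 1 - inner ℝ x (p x) := by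
      simp [v, inner_sub_right, hx]
    have h2 := real_inner_le_norm x (p x)
    rw [hx, one_mul] at h2
    linarith [hp1 x]
  have hD (x : E) (hx : ‖x‖ ≤ 1) : 0 < D x := by
    rcases hx.lt_or_eq with hx1 | hx1
    · have : 0 < 1 - ‖x‖ ^ 2 := by nlinarith [norm_nonneg x]
      have := mul_pos (hv x hx) this
      positivity
    · have := hinner x hx1
      simp only [D, hx1]
      positivity
  have hvd : ContDiff ℝ 1 v := contDiff_id.sub hp
  have hsm (x : E) (hx : ‖x‖ ≤ 1) : ContDiffAt ℝ 1 g x := by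
    have hi : ContDiffAt ℝ 1 (fun x => inner ℝ x (v x)) x := (contDiff_id.inner ℝ hvd).contDiffAt
    have hDd : ContDiffAt ℝ 1 D x :=
      (hi.pow 2).add ((hvd.contDiffAt.norm_sq ℝ).mul (contDiffAt_const.sub (contDiffAt_id.norm_sq ℝ)))
    exact ((hi.neg.add (hDd.sqrt (hD x hx).ne')).div (hvd.contDiffAt.norm_sq ℝ) (hv x hx).ne').smul
      hvd.contDiffAt
  have h0 (x : E) (hx : ‖x‖ = 1) : g x = 0 := by
    have : D x = inner ℝ x (v x) ^ 2 := by simp [D, hx]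
    simp [g, l, this, Real.sqrt_sq (hinner x hx).le]
  have hnorm (x : E) (hx : ‖x‖ ≤ 1) : ‖x + g x‖ = 1 := by
    have hs := Real.sq_sqrt (hD x hx).le
    have hvx := hv x hx
    have h1 : ‖x + g x‖ ^ 2 = 1 := by
      rw [norm_add_sq_real, inner_smul_right, norm_smul, mul_pow, Real.norm_eq_abs, sq_abs]
      have hl : l x * ‖v x‖ ^ 2 = -inner ℝ x (v x) + √(D x) := div_mul_cancel₀ _ hvx.ne'
      have h2 : (l x * ‖v x‖ ^ 2 + inner ℝ x (v x)) ^ 2 = D x := by rw [hl]; linear_combination hs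
      refine mul_right_cancel₀ hvx.ne' ?_
      have hDx : D x = inner ℝ x (v x) ^ 2 + ‖v x‖ ^ 2 * (1 - ‖x‖ ^ 2) := rfl
      nlinarith
    exact (pow_eq_one_iff_of_nonneg (norm_nonneg _) two_ne_zero).1 h1
  obtain ⟨C, hC⟩ := (isCompact_closedBall (0 : E) 1).exists_bound_of_continuousOn (f := fderiv ℝ g)
    fun x hx => ((hsm x (by simpa using hx)).continuousAt_fderiv one_ne_zero).continuousWithinAt
  have hlip : LipschitzOnWith C.toNNReal g (closedBall 0 1) := by
    refine Convex.lipschitzOnWith_of_nnnorm_fderiv_le (𝕜 := ℝ)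
      (fun x hx => (hsm x (by simpa using hx)).differentiableAt one_ne_zero)
      (fun x hx => ?_) (convex_closedBall 0 1)
    exact NNReal.coe_le_coe.1 ((hC x hx).trans (Real.le_coe_toNNReal C))
  have heq (x : E) (hx : x ∈ ball (0 : E) 1) : indicator (closedBall 0 1) g =ᶠ[nhds x] g := by
    filter_upwards [isOpen_ball.mem_nhds hx] with y hy
    exact indicator_of_mem (ball_subset_closedBall hy) _
  obtain ⟨x, hx, hdet⟩ := exists_fderiv_id_add_det_ne_zero
    (lipschitzWith_indicator_closedBall hlip h0) (fun x hx => by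
      by_cases h : x ∈ closedBall (0 : E) 1
      · rw [indicator_of_mem h, h0 x (le_antisymm (by simpa using h) hx)]
      · exact indicator_of_notMem h _)
    (fun x hx => ((hsm x (by simpa using (ball_subset_closedBall hx))).differentiableAt
      one_ne_zero).congr_of_eventuallyEq (heq x hx))
  have hx1 : ‖x‖ ≤ 1 := by simpa using ball_subset_closedBall hx
  rw [(heq x hx).fderiv_eq] at hdet
  refine hdet (det_eq_zero_of_norm_eq_one (r := fun x => x + g x) ((hasFDerivAt_id x).add
    ((hsm x hx1).differentiableAt one_ne_zero).hasFDerivAt) ?_)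
  filter_upwards [isOpen_ball.mem_nhds hx] with y hy
  exact hnorm y (by simpa using ball_subset_closedBall hy)

/-- **Brouwer's fixed point theorem** for bounded continuous self-maps of a Euclidean space. -/
theorem exists_fixedPoint_of_bounded {f : E → E} (hf : Continuous f) {R : ℝ}
    (hR : ∀ x, ‖f x‖ ≤ R) : ∃ x, f x = x := by
  by_contra! hfix
  have hR0 : 0 ≤ R := (norm_nonneg _).trans (hR 0)
  set S : ℝ := R + 2 with hS
  have hS0 : 0 < S := by positivity
  obtain ⟨x₀, -, hx₀⟩ := (isCompact_closedBall (0 : E) S).exists_isMinOn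
    ⟨0, by simp [hS0.le]⟩ ((hf.sub continuous_id).norm.continuousOn)
  set ε := min 1 ‖f x₀ - x₀‖ with hε
  have hε0 : 0 < ε := lt_min one_pos (norm_pos_iff.2 (sub_ne_zero.2 (hfix x₀)))
  obtain ⟨q, hq, hqf, -⟩ := hf.exists_contDiff_approx 1 (continuous_const (y := ε)) fun _ => hε0
  have hqn (x : E) : ‖q x‖ < S := by
    have h1 := hqf x
    rw [dist_eq_norm] at h1
    have h2 := norm_le_insert' (q x) (f x)
    linarith [hR x, min_le_left 1 ‖f x₀ - x₀‖]
  obtain ⟨x, hx1, hx⟩ := exists_fixedPoint_of_contDiff (p := fun x => S⁻¹ • q (S • x))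
    ((hq.comp (contDiff_const_smul S)).const_smul S⁻¹) fun x => by
      rw [norm_smul, norm_inv, Real.norm_of_nonneg hS0.le, inv_mul_lt_iff₀ hS0, mul_one]
      exact hqn _
  have hqx : q (S • x) = S • x := (inv_smul_eq_iff₀ hS0.ne').1 hx
  have h1 := hqf (S • x)
  have h2 : ‖f x₀ - x₀‖ ≤ ‖f (S • x) - S • x‖ := hx₀ (by
    simpa [norm_smul, abs_of_pos hS0] using mul_le_of_le_one_right hS0.le hx1)
  rw [hqx, dist_comm, dist_eq_norm] at h1
  linarith [min_le_right 1 ‖f x₀ - x₀‖]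

end Brouwer

section NerveRealization

open CategoryTheory Opposite Simplicial

theorem stdSimplex_map_apply_of_injective {X Y : Type*} [Fintype X] [Fintype Y] {f : X → Y}
    (hf : Function.Injective f) (s : stdSimplex ℝ X) (x : X) : stdSimplex.map f s (f x) = s x := by
  classical
  rw [stdSimplex.map_coe, FunOnFinite.linearMap_apply_apply]
  exact Finset.sum_eq_single_of_mem x (by simp) fun y hy hyx =>
    (hyx (hf (by simpa using hy))).elim

theorem stdSimplex_map_injective {X Y : Type*} [Fintype X] [Fintype Y] {f : X → Y}
    (hf : Function.Injective f) : Function.Injective (stdSimplex.map (S := ℝ) f) := fun s t h => by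
  ext x
  rw [← stdSimplex_map_apply_of_injective hf, h, stdSimplex_map_apply_of_injective hf]

theorem exists_of_stdSimplex_map_apply_ne_zero {X Y : Type*} [Fintype X] [Fintype Y] {f : X → Y}
    {s : stdSimplex ℝ X} {y : Y} (h : stdSimplex.map f s y ≠ 0) : ∃ x, s x ≠ 0 ∧ f x = y := by
  classical
  rw [stdSimplex.map_coe, FunOnFinite.linearMap_apply_apply] at h
  obtain ⟨x, hx, hne⟩ := Finset.exists_ne_zero_of_sum_ne_zero h
  exact ⟨x, hne, by simpa using hx⟩

/-- The order complex of a finite preorder, as the space of weights supported on chains. -/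
def OrderComplex (P : Type) [Preorder P] [Fintype P] : Type :=
  {x : stdSimplex ℝ P // IsChain (· ≤ ·) {p | x p ≠ 0}}

instance (P : Type) [Preorder P] [Fintype P] : TopologicalSpace (OrderComplex P) :=
  instTopologicalSpaceSubtype

instance (P : Type) [Preorder P] [Fintype P] : T2Space (OrderComplex P) :=
  inferInstanceAs (T2Space {x : stdSimplex ℝ P // IsChain (· ≤ ·) {p | x p ≠ 0}})

namespace OrderComplex

variable {P Q : Type} [Preorder P] [Fintype P] [Preorder Q] [Fintype Q]

theorem isChain_support_map (f : P →o Q) {x : stdSimplex ℝ P}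
    (hx : IsChain (· ≤ ·) {p | x p ≠ 0}) : IsChain (· ≤ ·) {q | stdSimplex.map f x q ≠ 0} := by
  refine (f.monotone.isChain_image hx).mono fun q hq => ?_
  obtain ⟨p, hp, rfl⟩ := exists_of_stdSimplex_map_apply_ne_zero hq
  exact ⟨p, hp, rfl⟩

/-- The map of order complexes induced by a monotone map. -/
noncomputable def map (f : P →o Q) : C(OrderComplex P, OrderComplex Q) where
  toFun x := ⟨stdSimplex.map f x.1, isChain_support_map f x.2⟩
  continuous_toFun := ((stdSimplex.continuous_map f).comp continuous_subtype_val).subtype_mk _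

/-- The simplex of the order complex spanned by a monotone sequence. -/
noncomputable def simplex {n : ℕ} (a : Fin (n + 1) →o P) :
    C(stdSimplex ℝ (Fin (n + 1)), OrderComplex P) where
  toFun w := ⟨stdSimplex.map a w, isChain_support_map a (isChain_of_trichotomous _)⟩
  continuous_toFun := (stdSimplex.continuous_map a).subtype_mk _

end OrderComplex

theorem TopCat.toSSetObjEquiv_map {X : TopCat.{0}} {m n : SimplexCategoryᵒᵖ} (f : m ⟶ n)
    (s : (TopCat.toSSet.obj X).obj m) (w : stdSimplex ℝ (Fin (n.unop.len + 1))) :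
    X.toSSetObjEquiv n ((TopCat.toSSet.obj X).map f s) w =
      X.toSSetObjEquiv m s (stdSimplex.map f.unop w) := rfl

variable {P : Type} [PartialOrder P] [Fintype P]

variable (P) in
/-- The singular simplices of the order complex given by the simplices of the nerve. -/
noncomputable def nerveToSSet : nerve P ⟶ TopCat.toSSet.obj (TopCat.of (OrderComplex P)) where
  app n := TypeCat.ofHom fun c => ((TopCat.of (OrderComplex P)).toSSetObjEquiv n).symm
    (OrderComplex.simplex ⟨c.obj, c.monotone⟩)
  naturality m n f := by
    ext c
    refine ((TopCat.of (OrderComplex P)).toSSetObjEquiv n).injective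
      (ContinuousMap.ext fun w => Subtype.ext ?_)
    exact (stdSimplex.map_comp_apply f.unop c.obj w).symm

theorem nerveToSSet_naturality {Q : Type} [PartialOrder Q] [Fintype Q] (f : P →o Q) :
    nerveMap f.monotone.functor ≫ nerveToSSet Q =
      nerveToSSet P ≫ TopCat.toSSet.map (TopCat.ofHom (OrderComplex.map f)) := by
  ext n c
  refine ((TopCat.of (OrderComplex Q)).toSSetObjEquiv n).injective
    (ContinuousMap.ext fun w => Subtype.ext ?_)
  exact (stdSimplex.map_comp_apply (CategoryTheory.Functor.obj c) f w).symm

variable (P) in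
/-- The canonical map from the realization of the nerve to the order complex. -/
noncomputable def realizationToOrderComplex :
    SSet.toTop.obj (nerve P) ⟶ TopCat.of (OrderComplex P) :=
  (sSetTopAdj.homEquiv _ _).symm (nerveToSSet P)

theorem realizationToOrderComplex_naturality {Q : Type} [PartialOrder Q] [Fintype Q] (f : P →o Q) :
    SSet.toTop.map (nerveMap f.monotone.functor) ≫ realizationToOrderComplex Q =
      realizationToOrderComplex P ≫ TopCat.ofHom (OrderComplex.map f) := by
  rw [realizationToOrderComplex, realizationToOrderComplex, ← Adjunction.homEquiv_naturality_left_symm,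
    nerveToSSet_naturality, Adjunction.homEquiv_naturality_right_symm]

/-- The simplex of the realization of the nerve given by a monotone sequence. -/
noncomputable def realizationSimplex {n : ℕ} (a : Fin (n + 1) →o P) :
    C(stdSimplex ℝ (Fin (n + 1)), SSet.toTop.obj (nerve P)) :=
  (SSet.toTop.obj (nerve P)).toSSetObjEquiv (op ⦋n⦌)
    ((sSetTopAdj.unit.app (nerve P)).app (op ⦋n⦌) a.monotone.functor)

omit [Fintype P] in
theorem realizationSimplex_comp {m n : ℕ} (a : Fin (n + 1) →o P) (f : Fin (m + 1) →o Fin (n + 1))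
    (w : stdSimplex ℝ (Fin (m + 1))) :
    realizationSimplex (a.comp f) w = realizationSimplex a (stdSimplex.map f w) := by
  let φ : (op ⦋n⦌ : SimplexCategoryᵒᵖ) ⟶ op ⦋m⦌ := (SimplexCategory.mkHom f).op
  have h1 := ConcreteCategory.congr_hom ((sSetTopAdj.unit.app (nerve P)).naturality φ)
    a.monotone.functor
  have h2 := TopCat.toSSetObjEquiv_map φ
    ((sSetTopAdj.unit.app (nerve P)).app (op ⦋n⦌) a.monotone.functor) w
  refine Eq.trans ?_ h2
  exact DFunLike.congr_fun
    (congrArg ((SSet.toTop.obj (nerve P)).toSSetObjEquiv (op ⦋m⦌)) h1) w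

theorem realizationToOrderComplex_realizationSimplex {n : ℕ} (a : Fin (n + 1) →o P)
    (w : stdSimplex ℝ (Fin (n + 1))) :
    realizationToOrderComplex P (realizationSimplex a w) = OrderComplex.simplex a w := by
  have h : sSetTopAdj.unit.app (nerve P) ≫ TopCat.toSSet.map (realizationToOrderComplex P) =
      nerveToSSet P :=
    (sSetTopAdj.homEquiv_unit (nerve P) _ _).symm.trans (Equiv.apply_symm_apply _ _)
  have h1 : (TopCat.toSSet.map (realizationToOrderComplex P)).app (op ⦋n⦌)
      ((sSetTopAdj.unit.app (nerve P)).app (op ⦋n⦌) a.monotone.functor) =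
      (nerveToSSet P).app (op ⦋n⦌) a.monotone.functor := by
    rw [← h]; rfl
  exact DFunLike.congr_fun
    (congrArg ((TopCat.of (OrderComplex P)).toSSetObjEquiv (op ⦋n⦌)) h1) w

theorem OrderComplex.exists_simplex_eq (x : OrderComplex P) :
    ∃ (n : ℕ) (a : Fin (n + 1) ↪o P) (w : stdSimplex ℝ (Fin (n + 1))),
      Set.range a = {p | x.1 p ≠ 0} ∧ OrderComplex.simplex (a : Fin (n + 1) →o P) w = x := by
  classical
  let S := {p : P // x.1 p ≠ 0}
  let _ : LinearOrder S :=
    { (inferInstance : PartialOrder S) with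
      le_total := fun p q => x.2.total p.2 q.2
      toDecidableLE := Classical.decRel _ }
  have hne : Nonempty S := by
    by_contra hS
    have h0 (p : P) : x.1 p = 0 := by
      by_contra hp
      exact hS ⟨p, hp⟩
    have := stdSimplex.sum_eq_one x.1
    simp [h0] at this
  obtain ⟨n, hn⟩ := Nat.exists_eq_succ_of_ne_zero (Fintype.card_ne_zero (α := S))
  let e : Fin (n + 1) ≃o S := Fintype.orderIsoFinOfCardEq S hn
  let a : Fin (n + 1) ↪o P := e.toOrderEmbedding.trans (OrderEmbedding.subtype _)
  have hrange : Set.range a = {p | x.1 p ≠ 0} := by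
    ext p
    constructor
    · rintro ⟨i, rfl⟩
      exact (e i).2
    · intro hp
      exact ⟨e.symm ⟨p, hp⟩, by simp [a]; rfl⟩
  let w : stdSimplex ℝ (Fin (n + 1)) := ⟨fun i => x.1 (a i), fun i => x.1.2.1 _, by
    rw [← stdSimplex.sum_eq_one x.1, ← Finset.sum_image (f := fun p => x.1 p) a.injective.injOn]
    refine Finset.sum_subset (Finset.subset_univ _) fun p _ hp => ?_
    by_contra hne
    obtain ⟨i, rfl⟩ := hrange.ge hne
    exact hp (Finset.mem_image_of_mem a (Finset.mem_univ i))⟩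
  refine ⟨n, a, w, hrange, Subtype.ext (stdSimplex.ext (funext fun p => ?_))⟩
  by_cases hp : x.1 p = 0
  · rw [hp]
    by_contra hne
    obtain ⟨i, -, rfl⟩ := exists_of_stdSimplex_map_apply_ne_zero hne
    exact hrange.le ⟨i, rfl⟩ hp
  · obtain ⟨i, rfl⟩ := hrange.ge hp
    exact stdSimplex_map_apply_of_injective a.injective w i

theorem realizationSimplex_eq_of_range_subset {m n : ℕ} {a : Fin (n + 1) ↪o P}
    {d : Fin (m + 1) ↪o P} (had : Set.range d ⊆ Set.range a) {w : stdSimplex ℝ (Fin (n + 1))}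
    {u : stdSimplex ℝ (Fin (m + 1))}
    (h : OrderComplex.simplex (a : Fin (n + 1) →o P) w = OrderComplex.simplex (d : _ →o P) u) :
    realizationSimplex (a : Fin (n + 1) →o P) w = realizationSimplex (d : _ →o P) u := by
  choose f hf using fun i => had ⟨i, rfl⟩
  let g : Fin (m + 1) →o Fin (n + 1) := ⟨f, fun i j hij => by
    rw [← a.le_iff_le, hf, hf]
    exact d.monotone hij⟩
  have hd : (d : Fin (m + 1) →o P) = (a : Fin (n + 1) →o P).comp g := by
    ext i
    exact (hf i).symm
  rw [hd, realizationSimplex_comp]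
  congr 1
  refine stdSimplex_map_injective a.injective ?_
  rw [stdSimplex.map_comp_apply]
  have h1 := congrArg Subtype.val h
  rw [hd] at h1
  exact h1

theorem realizationSimplex_eq {m n : ℕ} {a : Fin (n + 1) ↪o P}
    {b : Fin (m + 1) ↪o P} {w : stdSimplex ℝ (Fin (n + 1))} {v : stdSimplex ℝ (Fin (m + 1))}
    (h : OrderComplex.simplex (a : Fin (n + 1) →o P) w = OrderComplex.simplex (b : _ →o P) v) :
    realizationSimplex (a : Fin (n + 1) →o P) w = realizationSimplex (b : _ →o P) v := by
  obtain ⟨k, d, u, hd, hu⟩ := OrderComplex.exists_simplex_eq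
    (OrderComplex.simplex (a : Fin (n + 1) →o P) w)
  have hsub {l : ℕ} (c : Fin (l + 1) ↪o P) (t : stdSimplex ℝ (Fin (l + 1)))
      (hc : OrderComplex.simplex (a : Fin (n + 1) →o P) w = OrderComplex.simplex (c : _ →o P) t) :
      Set.range d ⊆ Set.range c := by
    rw [hd, hc]
    intro p hp
    obtain ⟨i, -, rfl⟩ := exists_of_stdSimplex_map_apply_ne_zero hp
    exact ⟨i, rfl⟩
  rw [realizationSimplex_eq_of_range_subset (hsub a w rfl) hu.symm,
    realizationSimplex_eq_of_range_subset (hsub b v h) (h.symm.trans hu.symm)]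

variable (P) in
theorem exists_realizationToOrderComplex_section :
    ∃ s : C(OrderComplex P, SSet.toTop.obj (nerve P)),
      ∀ x, realizationToOrderComplex P (s x) = x := by
  let J := Σ n : Fin (Fintype.card P), (Fin ((n : ℕ) + 1) ↪o P)
  have _ : Finite J := by
    have (n : Fin (Fintype.card P)) : Finite (Fin ((n : ℕ) + 1) ↪o P) :=
      Finite.of_injective (fun a => (a : Fin ((n : ℕ) + 1) → P)) DFunLike.coe_injective
    infer_instance
  let Z := Σ j : J, stdSimplex ℝ (Fin ((j.1 : ℕ) + 1))
  let q : C(Z, OrderComplex P) :=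
    ContinuousMap.sigma fun j => OrderComplex.simplex (j.2 : Fin ((j.1 : ℕ) + 1) →o P)
  let Φ : C(Z, SSet.toTop.obj (nerve P)) :=
    ContinuousMap.sigma fun j => realizationSimplex (j.2 : Fin ((j.1 : ℕ) + 1) →o P)
  have hsurj : Function.Surjective q := fun x => by
    obtain ⟨n, a, w, -, hx⟩ := OrderComplex.exists_simplex_eq x
    have hn : n < Fintype.card P := by
      simpa using Fintype.card_le_of_injective a a.injective
    exact ⟨⟨⟨⟨n, hn⟩, a⟩, w⟩, hx⟩
  have hq : Topology.IsQuotientMap q := q.continuous.isClosedMap.isQuotientMap q.continuous hsurj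
  have hfac : Function.FactorsThrough Φ q := fun y z h => realizationSimplex_eq h
  refine ⟨hq.lift Φ hfac, fun x => ?_⟩
  obtain ⟨z, rfl⟩ := hsurj x
  exact (congrArg (realizationToOrderComplex P) (DFunLike.congr_fun (hq.lift_comp Φ hfac) z)).trans
    (realizationToOrderComplex_realizationSimplex (z.1.2 : Fin ((z.1.1 : ℕ) + 1) →o P) z.2)

end NerveRealization

section FixedPoint

variable {P : Type} [PartialOrder P] [Fintype P]

theorem exists_simplexRetraction (P : Type*) [Fintype P] [Nonempty P] :
    ∃ π : EuclideanSpace ℝ P → stdSimplex ℝ P, Continuous π ∧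
      ∀ z : stdSimplex ℝ P, π (WithLp.toLp 2 z) = z := by
  let S (x : EuclideanSpace ℝ P) : ℝ := ∑ q, max (x q) 0
  let y (x : EuclideanSpace ℝ P) (p : P) : ℝ := max (x p) 0 + max (1 - S x) 0
  have hS (x) : 0 ≤ S x := Finset.sum_nonneg fun q _ => le_max_right _ _
  have hy (x p) : 0 ≤ y x p := add_nonneg (le_max_right _ _) (le_max_right _ _)
  have hsum (x) : 0 < ∑ p, y x p := by
    simp only [y]
    rw [Finset.sum_add_distrib, Finset.sum_const, nsmul_eq_mul]
    change 0 < S x + _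
    have hc : (0 : ℝ) < (Finset.univ : Finset P).card := by
      exact_mod_cast Finset.card_pos.2 Finset.univ_nonempty
    rcases (hS x).eq_or_lt with h | h
    · rw [← h]
      simpa using hc
    · exact add_pos_of_pos_of_nonneg h (mul_nonneg hc.le (le_max_right _ _))
  have hSc : Continuous S := by fun_prop
  have hyc (p) : Continuous fun x => y x p := by fun_prop
  refine ⟨fun x => ⟨fun p => y x p / ∑ q, y x q, fun p => div_nonneg (hy x p) (hsum x).le, ?_⟩,
    Continuous.subtype_mk (continuous_pi fun p => (hyc p).div
      (continuous_finsetSum _ fun q _ => hyc q) fun x => (hsum x).ne') _, fun z => ?_⟩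
  · rw [← Finset.sum_div, div_self (hsum x).ne']
  · have hz (p) : max (z p) 0 = z p := max_eq_left (z.2.1 p)
    have hSz : S (WithLp.toLp 2 z) = 1 := by
      simp only [S, hz]
      exact stdSimplex.sum_eq_one z
    have hyz (p) : y (WithLp.toLp 2 z) p = z p := by
      simp only [y, hSz, hz]
      simp
    refine stdSimplex.ext (funext fun p => ?_)
    change y (WithLp.toLp 2 z) p / ∑ q, y (WithLp.toLp 2 z) q = z p
    simp only [hyz, stdSimplex.sum_eq_one z, div_one]

theorem exists_fixedPoint_of_stdSimplex {P : Type*} [Fintype P] [Nonempty P]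
    {f : stdSimplex ℝ P → stdSimplex ℝ P} (hf : Continuous f) : ∃ x, f x = x := by
  obtain ⟨π, hπ, hid⟩ := exists_simplexRetraction P
  let j (z : stdSimplex ℝ P) : EuclideanSpace ℝ P := WithLp.toLp 2 z
  have hj : Continuous j := (PiLp.continuous_toLp 2 _).comp continuous_subtype_val
  obtain ⟨R, hR⟩ := isCompact_univ.exists_bound_of_continuousOn hj.continuousOn
  obtain ⟨x, hx⟩ := exists_fixedPoint_of_bounded (hj.comp (hf.comp hπ))
    fun x => hR (f (π x)) trivial
  refine ⟨π x, ?_⟩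
  conv_rhs => rw [← hx]
  exact (hid _).symm

/-- A measure of the failure of the support of a weight to be a chain. -/
noncomputable def chainDefect (x : stdSimplex ℝ P) : ℝ :=
  open Classical in
  ∑ pq : P × P, if pq.1 ≤ pq.2 ∨ pq.2 ≤ pq.1 then 0 else min (x pq.1) (x pq.2)

theorem chainDefect_nonneg (x : stdSimplex ℝ P) : 0 ≤ chainDefect x :=
  Finset.sum_nonneg fun pq _ => by
    split_ifs
    exacts [le_rfl, le_min (x.2.1 _) (x.2.1 _)]

theorem continuous_chainDefect : Continuous (chainDefect (P := P)) := by
  have h (p : P) : Continuous fun x : stdSimplex ℝ P => x p :=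
    (continuous_apply p).comp continuous_subtype_val
  refine continuous_finsetSum _ fun pq _ => ?_
  split_ifs
  exacts [continuous_const, (h _).min (h _)]

theorem chainDefect_eq_zero (x : OrderComplex P) : chainDefect x.1 = 0 :=
  Finset.sum_eq_zero fun pq _ => by
    split_ifs with h
    · rfl
    · have h1 : x.1 pq.1 = 0 ∨ x.1 pq.2 = 0 := by
        by_contra! hne
        exact h (x.2.total hne.1 hne.2)
      rcases h1 with h1 | h1
      · rw [h1]
        exact min_eq_left (x.1.2.1 _)
      · rw [h1]
        exact min_eq_right (x.1.2.1 _)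

theorem le_or_le_of_chainDefect_lt {x : stdSimplex ℝ P} {p q : P} (hp : chainDefect x < x p)
    (hq : chainDefect x < x q) : p ≤ q ∨ q ≤ p := by
  classical
  by_contra h
  have h1 := Finset.single_le_sum (f := fun pq : P × P =>
    if pq.1 ≤ pq.2 ∨ pq.2 ≤ pq.1 then 0 else min (x pq.1) (x pq.2)) (fun pq _ => by
      split_ifs
      exacts [le_rfl, le_min (x.2.1 _) (x.2.1 _)]) (Finset.mem_univ (p, q))
  rw [if_neg h] at h1
  exact h1.not_gt (lt_min hp hq)

theorem exists_truncation [Nonempty P] : ∃ δ : ℝ, 0 < δ ∧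
    ∃ ρ : C({x : stdSimplex ℝ P | chainDefect x ≤ δ}, OrderComplex P),
      ∀ x p, (ρ x).1 p ≠ 0 → x.1 p ≠ 0 := by
  let δ : ℝ := 1 / (2 * Fintype.card P)
  have hc : (0 : ℝ) < Fintype.card P := by exact_mod_cast Fintype.card_pos
  have hδ : 0 < δ := by positivity
  let y (x : stdSimplex ℝ P) (p : P) : ℝ := max (x p - δ) 0
  have hy (x p) : 0 ≤ y x p := le_max_right _ _
  have hsum (x) : 0 < ∑ p, y x p := by
    have h1 : ∑ p, (x p - δ) ≤ ∑ p, y x p := Finset.sum_le_sum fun p _ => le_max_left _ _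
    refine lt_of_lt_of_le ?_ h1
    rw [Finset.sum_sub_distrib, stdSimplex.sum_eq_one, Finset.sum_const, nsmul_eq_mul,
      Finset.card_univ]
    simp only [δ]
    field_simp
    norm_num
  have hyc (p) : Continuous fun x => y x p :=
    (((continuous_apply p).comp continuous_subtype_val).sub continuous_const).max continuous_const
  have hpos {x p} (h : y x p / ∑ q, y x q ≠ 0) : δ < x p := by
    by_contra! hle
    exact h (by simp [y, hle])
  refine ⟨δ, hδ, ⟨fun x => ⟨⟨fun p => y x.1 p / ∑ q, y x.1 q,
    fun p => div_nonneg (hy _ p) (hsum _).le, ?_⟩, ?_⟩, ?_⟩, fun x p hp => ?_⟩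
  · rw [← Finset.sum_div, div_self (hsum _).ne']
  · intro p hp q hq _
    exact le_or_le_of_chainDefect_lt (x.2.trans_lt (hpos hp)) (x.2.trans_lt (hpos hq))
  · exact ((continuous_pi fun p => (hyc p).div
      (continuous_finsetSum _ fun q _ => hyc q) fun x => (hsum x).ne').comp
        continuous_subtype_val |>.subtype_mk _).subtype_mk _
  · exact (hδ.trans (hpos hp)).ne'

theorem OrderComplex.exists_fixed_of_map_eq {T : P →o P} {x z : OrderComplex P}
    (hx : OrderComplex.map T x = z) (hsub : ∀ p, x.1 p ≠ 0 → z.1 p ≠ 0) : ∃ p, T p = p := by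
  classical
  let C : Finset P := Finset.univ.filter fun p => z.1 p ≠ 0
  have hmem {p} : p ∈ C ↔ z.1 p ≠ 0 := by simp [C]
  have hC : C ⊆ C.image T := fun c hc => by
    rw [hmem, ← hx] at hc
    obtain ⟨p, hp, rfl⟩ := exists_of_stdSimplex_map_apply_ne_zero hc
    exact Finset.mem_image_of_mem T (hmem.2 (hsub p hp))
  have heq : C = C.image T := Finset.eq_of_subset_of_card_le hC Finset.card_image_le
  have hne : C.Nonempty := by
    by_contra! hC0
    have h0 (p : P) : z.1 p = 0 := by
      by_contra hp
      simpa [hC0] using hmem.2 hp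
    have := stdSimplex.sum_eq_one z.1
    simp [h0] at this
  obtain ⟨m, hm⟩ := C.exists_minimal hne
  have hmin {p} (hp : p ∈ C) : m ≤ p :=
    (z.2.total (hmem.1 hm.1) (hmem.1 hp)).elim id fun h => hm.2 hp h
  obtain ⟨p, hp, hpm⟩ := Finset.mem_image.1 (hC hm.1)
  exact ⟨m, le_antisymm ((T.monotone (hmin hp)).trans_eq hpm)
    (hmin (heq ▸ Finset.mem_image_of_mem T hm.1))⟩

theorem exists_fixed_of_retract {Y : Type*} [TopologicalSpace Y] [ContractibleSpace Y]
    [Nonempty P] (i : C(Y, OrderComplex P)) (s : C(OrderComplex P, Y)) (his : ∀ x, i (s x) = x)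
    (t : C(Y, Y)) (T : P →o P) (hT : ∀ y, i (t y) = OrderComplex.map T (i y)) :
    ∃ p, T p = p := by
  classical
  obtain ⟨δ, hδ, ρ, hρ⟩ := exists_truncation (P := P)
  obtain ⟨y₀, ⟨H⟩⟩ := id_nullhomotopic Y
  let A : Set (stdSimplex ℝ P) := {x | chainDefect x ≤ δ}
  let B : Set (stdSimplex ℝ P) := {x | δ ≤ chainDefect x}
  have hA : IsClosed A := isClosed_le continuous_chainDefect continuous_const
  have hB : IsClosed B := isClosed_le continuous_const continuous_chainDefect
  let v (x : A) : unitInterval := ⟨chainDefect x.1 / δ,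
    div_nonneg (chainDefect_nonneg _) hδ.le, (div_le_one hδ).2 x.2⟩
  have hv : Continuous v :=
    ((continuous_chainDefect.comp continuous_subtype_val).div_const δ).subtype_mk _
  let r (x : stdSimplex ℝ P) : Y := if h : x ∈ A then H (v ⟨x, h⟩, s (ρ ⟨x, h⟩)) else y₀
  have hrA : ContinuousOn r A := by
    rw [continuousOn_iff_continuous_domRestrict]
    have : A.domRestrict r = fun x => H (v x, s (ρ x)) := funext fun x => dif_pos x.2
    rw [this]
    exact H.continuous.comp (hv.prodMk (s.continuous.comp ρ.continuous))
  have hrB : ContinuousOn r B := by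
    refine continuousOn_const (c := y₀) |>.congr fun x hx => ?_
    by_cases h : x ∈ A
    · have h1 : v ⟨x, h⟩ = 1 := Subtype.ext ((div_eq_one_iff_eq hδ.ne').2 (le_antisymm h hx))
      simp [r, h, h1]
    · exact dif_neg h
  have hr : Continuous r := by
    rw [← continuousOn_univ, ← Set.eq_univ_of_forall (s := A ∪ B) fun x => le_total (chainDefect x) δ]
    exact hrA.union_of_isClosed hrB hA hB
  obtain ⟨x, hx⟩ := exists_fixedPoint_of_stdSimplex
    (continuous_subtype_val.comp (i.continuous.comp (t.continuous.comp hr)))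
  let z : OrderComplex P := i (t (r x))
  have hzx : z.1 = x := hx
  have h0 : chainDefect x = 0 := hzx ▸ chainDefect_eq_zero z
  have hxA : x ∈ A := h0.trans_le hδ.le
  have hrx : r x = s (ρ ⟨x, hxA⟩) := by
    have h1 : v ⟨x, hxA⟩ = 0 := Subtype.ext (by simp [v, h0])
    simp [r, hxA, h1]
  refine OrderComplex.exists_fixed_of_map_eq (T := T) (x := ρ ⟨x, hxA⟩) (z := z) ?_ fun p hp => ?_
  · rw [← his (ρ ⟨x, hxA⟩), ← hT, ← hrx]
  · rw [hzx]
    exact hρ ⟨x, hxA⟩ p hp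

theorem exists_fixed_of_contractibleSpace_nerve (P : Type) [PartialOrder P] [Finite P]
    [ContractibleSpace (SSet.toTop.obj (CategoryTheory.nerve P))] (T : P →o P) :
    ∃ p, T p = p := by
  have := Fintype.ofFinite P
  obtain ⟨s, hs⟩ := exists_realizationToOrderComplex_section P
  have hP : Nonempty P := by
    by_contra hP
    obtain ⟨y⟩ : Nonempty (SSet.toTop.obj (CategoryTheory.nerve P)) := inferInstance
    obtain ⟨n, a, -⟩ := OrderComplex.exists_simplex_eq (realizationToOrderComplex P y)
    exact hP ⟨a 0⟩
  exact exists_fixed_of_retract (realizationToOrderComplex P).hom s hs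
    (SSet.toTop.map (CategoryTheory.nerveMap T.monotone.functor)).hom T fun y =>
      CategoryTheory.ConcreteCategory.congr_hom (realizationToOrderComplex_naturality T) y

end FixedPoint

section AbelianPart

theorem exists_retraction_zpowers {E : Type*} [CommGroup E] [Finite E] {e : E}
    (he : orderOf e = Monoid.exponent E) :
    ∃ r : E →* Subgroup.zpowers e, ∀ x : Subgroup.zpowers e, r x = x := by
  have : NeZero (Monoid.exponent E) := ⟨Monoid.exponent_ne_zero_of_finite⟩
  let R := rootsOfUnity (Monoid.exponent E) ℂ
  have hcard : Nat.card (Subgroup.zpowers e) = Nat.card R := by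
    rw [Nat.card_zpowers, he]
    exact (HasEnoughRootsOfUnity.natCard_rootsOfUnity ℂ _).symm
  have : IsCyclic R := HasEnoughRootsOfUnity.rootsOfUnity_isCyclic ℂ _
  let ι : Subgroup.zpowers e ≃* R := mulEquivOfCyclicCardEq hcard
  obtain ⟨χ, hχ⟩ := MonoidHom.domRestrict_surjective ℂ (Subgroup.zpowers e)
    (R.subtype.comp ι.toMonoidHom)
  have hmem (x : E) : χ x ∈ R := by
    rw [mem_rootsOfUnity, ← map_pow, Monoid.pow_exponent_eq_one, map_one]
  refine ⟨ι.symm.toMonoidHom.comp (χ.codRestrict R hmem), fun x => ?_⟩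
  have hx : χ.codRestrict R hmem x = ι x := Subtype.ext (DFunLike.congr_fun hχ x)
  change ι.symm (χ.codRestrict R hmem x) = x
  rw [hx, MulEquiv.symm_apply_apply]

/-- A finite commutative group is a cyclic module over the subring generated by some nilpotent
endomorphism. -/
theorem exists_nilpotent_end_cyclic (n : ℕ) : ∀ (E : Type) [CommGroup E] [Finite E],
    Nat.card E = n → ∃ (ψ : E →* E) (e : E), (∃ k, ∀ x, ψ^[k] x = 1) ∧
      ∀ W : Subgroup E, (∀ w ∈ W, ψ w ∈ W) → e ∈ W → W = ⊤ := by
  induction n using Nat.strong_induction_on with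
  | _ n ih =>
  intro E _ _ hn
  obtain ⟨e, he⟩ := Monoid.exists_orderOf_eq_exponent (Monoid.ExponentExists.of_finite (G := E))
  obtain ⟨r, hr⟩ := exists_retraction_zpowers he
  rcases subsingleton_or_nontrivial E with hE | hE
  · exact ⟨1, 1, ⟨0, fun x => Subsingleton.elim _ _⟩, fun W _ _ => Subsingleton.elim _ _⟩
  have hlt : Nat.card r.ker < n := by
    rw [← hn]
    refine lt_of_le_of_ne (Subgroup.card_le_card_group _) fun h => ?_
    have h1 : e ∈ r.ker := (Subgroup.card_eq_iff_eq_top _).1 h ▸ Subgroup.mem_top e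
    have h2 := hr ⟨e, Subgroup.mem_zpowers e⟩
    rw [MonoidHom.mem_ker] at h1
    have h3 : e = 1 := congrArg Subtype.val (h2.symm.trans h1)
    rw [h3, orderOf_one] at he
    exact not_subsingleton E (Monoid.exp_eq_one_iff.1 he.symm)
  obtain ⟨ψ, e', ⟨k, hk⟩, hgen⟩ := ih _ hlt r.ker rfl
  have hdvd : orderOf e' ∣ orderOf (⟨e, Subgroup.mem_zpowers e⟩ : Subgroup.zpowers e) := by
    rw [← Subgroup.orderOf_coe, ← Subgroup.orderOf_coe]
    exact (Monoid.order_dvd_exponent _).trans he.symm.dvd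
  have hgene (x : Subgroup.zpowers e) :
      x ∈ Subgroup.zpowers (⟨e, Subgroup.mem_zpowers e⟩ : Subgroup.zpowers e) := by
    obtain ⟨x, m, rfl⟩ := x
    exact ⟨m, rfl⟩
  let c : Subgroup.zpowers e →* r.ker := monoidHomOfForallMemZpowers hgene hdvd
  have hc : c ⟨e, Subgroup.mem_zpowers e⟩ = e' := monoidHomOfForallMemZpowers_apply_gen _ _
  let π : E →* r.ker := (MonoidHom.id E / (Subgroup.subtype _).comp r).codRestrict r.ker
    fun x => by
      rw [MonoidHom.mem_ker, MonoidHom.div_apply, map_div]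
      exact div_eq_one.2 (hr (r x)).symm
  let Ψ : E →* E := (Subgroup.subtype _).comp (c.comp r * ψ.comp π)
  have hΨK (x : r.ker) : Ψ x = ψ x := by
    have h1 : r x = 1 := x.2
    have h2 : π x = x := Subtype.ext (by simp [π, h1])
    simp [Ψ, h1, h2]
  have hΨe : Ψ e = e' := by
    have h1 : r e = ⟨e, Subgroup.mem_zpowers e⟩ := hr ⟨e, Subgroup.mem_zpowers e⟩
    have h2 : π e = 1 := Subtype.ext (by simp [π, h1])
    simp [Ψ, h1, h2, hc]
  refine ⟨Ψ, e, ⟨k + 1, fun x => ?_⟩, fun W hW heW => ?_⟩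
  · have h1 (m : ℕ) (y : r.ker) : Ψ^[m] y = ψ^[m] y := by
      induction m generalizing y with
      | zero => rfl
      | succ m ihm => rw [Function.iterate_succ_apply, Function.iterate_succ_apply, hΨK, ihm]
    rw [Function.iterate_succ_apply]
    exact (h1 k ((c.comp r * ψ.comp π) x)).trans (congrArg Subtype.val (hk _))
  · have h1 : W.comap (Subgroup.subtype r.ker) = ⊤ := by
      refine hgen _ (fun w hw => ?_) ?_
      · change (ψ w : E) ∈ W
        rw [← hΨK]
        exact hW _ hw
      · change (e' : E) ∈ W
        rw [← hΨe]
        exact hW e heW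
    refine (Subgroup.eq_top_iff' W).2 fun x => ?_
    have h2 : (π x : E) ∈ W := h1.ge (Subgroup.mem_top (π x))
    have h3 : (r x : E) ∈ W := (Subgroup.zpowers_le.2 heW) (r x).2
    have h4 : x = π x * r x := by simp [π]
    rw [h4]
    exact W.mul_mem h2 h3

theorem exists_end_mul (E : Type) [CommGroup E] [Finite E] : ∃ (ψ : E →* E) (e : E),
    ∀ W : Subgroup E, (∀ w ∈ W, ψ w ∈ W) → ∀ x, e * ψ x ∈ W → W = ⊤ := by
  obtain ⟨ψ, e, ⟨k, hk⟩, hgen⟩ := exists_nilpotent_end_cyclic _ E rfl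
  refine ⟨ψ, e, fun W hW x hx => ?_⟩
  have h1 : W ⊔ ψ.range = ⊤ := by
    refine hgen _ (fun w _ => Subgroup.mem_sup_right ⟨w, rfl⟩) ?_
    rw [← mul_inv_cancel_right e (ψ x)]
    exact mul_mem (Subgroup.mem_sup_left hx) (Subgroup.mem_sup_right ⟨x⁻¹, map_inv _ _⟩)
  have h2 (m : ℕ) (y : E) : ∃ w ∈ W, ∃ z, y = w * ψ^[m] z := by
    induction m generalizing y with
    | zero => exact ⟨1, W.one_mem, y, (one_mul y).symm⟩
    | succ m ihm =>
      obtain ⟨w, hw, z, rfl⟩ := ihm y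
      obtain ⟨u, hu, -, ⟨v, rfl⟩, rfl⟩ := Subgroup.mem_sup.1 (h1.ge (Subgroup.mem_top z))
      have hiter (l : ℕ) : ψ^[l] u ∈ W := by
        induction l with
        | zero => exact hu
        | succ l ihl =>
          rw [Function.iterate_succ_apply']
          exact hW _ ihl
      exact ⟨w * ψ^[m] u, W.mul_mem hw (hiter m), v, by
        rw [iterate_map_mul, mul_assoc, ← Function.iterate_succ_apply]⟩
  refine (Subgroup.eq_top_iff' W).2 fun y => ?_
  obtain ⟨w, hw, z, rfl⟩ := h2 k y
  rwa [hk, mul_one]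

end AbelianPart

section NormalSubgroups

variable {G : Type*} [Group G]

/-- A subgroup is maximal normal if it is maximal among the proper normal subgroups. -/
def IsMaximalNormal (M : Subgroup G) : Prop :=
  Maximal (fun N : Subgroup G => N.Normal ∧ N ≠ ⊤) M

theorem exists_le_isMaximalNormal [Finite G] {N : Subgroup G} (hN : N.Normal) (hne : N ≠ ⊤) :
    ∃ M, N ≤ M ∧ IsMaximalNormal M :=
  (Set.toFinite {N : Subgroup G | N.Normal ∧ N ≠ ⊤}).exists_le_maximal ⟨hN, hne⟩

theorem IsMaximalNormal.sup_eq_top {M K : Subgroup G} (hM : IsMaximalNormal M) (hK : K.Normal)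
    (hle : ¬ K ≤ M) : K ⊔ M = ⊤ := by
  have := hM.1.1
  by_contra h
  exact hle (le_sup_left.trans (hM.2 ⟨inferInstance, h⟩ le_sup_right))

theorem commutator_sup_sup_le {X Y M : Subgroup G} [M.Normal] :
    ⁅X ⊔ M, Y ⊔ M⁆ ≤ ⁅X, Y⁆ ⊔ M := by
  have h1 : M.map (QuotientGroup.mk' M) = ⊥ := by
    rw [Subgroup.map_eq_bot_iff, QuotientGroup.ker_mk']
  have h2 : ⁅X ⊔ M, Y ⊔ M⁆.map (QuotientGroup.mk' M) ≤ ⁅X, Y⁆.map (QuotientGroup.mk' M) := by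
    rw [Subgroup.map_commutator, Subgroup.map_commutator, Subgroup.map_sup, Subgroup.map_sup, h1,
      sup_bot_eq, sup_bot_eq]
  rwa [Subgroup.map_le_map_iff, QuotientGroup.ker_mk'] at h2

/-- Maximal normal subgroups with nonabelian quotient are prime. -/
theorem IsMaximalNormal.le_or_le {M X Y : Subgroup G} (hM : IsMaximalNormal M)
    (hab : ¬ commutator G ≤ M) (hX : X.Normal) (hY : Y.Normal) (h : X ⊓ Y ≤ M) :
    X ≤ M ∨ Y ≤ M := by
  have := hM.1.1
  by_contra! hne
  refine hab ?_
  have h1 : ⁅X ⊔ M, Y ⊔ M⁆ ≤ M :=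
    commutator_sup_sup_le.trans (sup_le ((Subgroup.commutator_le_inf X Y).trans h) le_rfl)
  rwa [hM.sup_eq_top hX hne.1, hM.sup_eq_top hY hne.2] at h1

theorem le_commutator_sup_inf {B M : Subgroup G} (hB : B.Normal) (hM : M.Normal)
    (hBM : B ⊔ M = ⊤) (hM' : M ⊔ commutator G = ⊤) : B ≤ commutator G ⊔ (B ⊓ M) := by
  have h1 : ⁅B, B⁆ ⊔ M = ⊤ := by
    rw [eq_top_iff, ← hM', sup_le_iff]
    refine ⟨le_sup_right, ?_⟩
    have h2 := commutator_sup_sup_le (X := B) (Y := B) (M := M)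
    rwa [hBM] at h2
  intro b hb
  obtain ⟨x, hx, m, hm, rfl⟩ := Subgroup.mem_sup_of_normal_right.1 (h1.ge (Subgroup.mem_top b))
  refine mul_mem (Subgroup.mem_sup_left (Subgroup.commutator_mono le_top le_top hx))
    (Subgroup.mem_sup_right ⟨?_, hm⟩)
  exact (B.mul_mem_cancel_left (Subgroup.commutator_le_left B B hx)).1 hb

/-- The intersection `B` of the maximal normal subgroups with nonabelian quotient is
complementary to the commutator subgroup, and some element avoids all of them. -/
theorem exists_normal_sup_commutator_eq_top (G : Type*) [Group G] [Finite G] :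
    ∃ (B : Subgroup G) (a : G), B.Normal ∧ B ⊔ commutator G = ⊤ ∧
      ∀ M, IsMaximalNormal M → ¬ commutator G ≤ M → B ≤ M ∧ a ∉ M := by
  let S : Set (Subgroup G) := {B | B.Normal ∧ B ⊔ commutator G = ⊤ ∧
    ∃ a, ∀ M, IsMaximalNormal M → ¬ commutator G ≤ M → B ≤ M → a ∉ M}
  have hS : (⊤ : Subgroup G) ∈ S :=
    ⟨inferInstance, top_sup_eq _, 1, fun M hM _ h => (hM.1.2 (top_le_iff.1 h)).elim⟩
  obtain ⟨B, -, ⟨hB, hBG, a, ha⟩, hmin⟩ := (Set.toFinite S).exists_le_minimal hS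
  have hle {M} (hM : IsMaximalNormal M) (hab : ¬ commutator G ≤ M) : B ≤ M := by
    by_contra hBM
    have hMn := hM.1.1
    have htop := hM.sup_eq_top hB hBM
    have hMG : M ⊔ commutator G = ⊤ := (sup_comm _ _).trans (hM.sup_eq_top inferInstance hab)
    suffices hmem : B ⊓ M ∈ S from hBM ((hmin hmem inf_le_left).trans inf_le_right)
    refine ⟨inferInstance, ?_, ?_⟩
    · rw [eq_top_iff, ← htop, sup_comm (B ⊓ M)]
      refine sup_le (le_commutator_sup_inf hB hMn htop hMG) ?_
      rw [inf_comm]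
      exact le_commutator_sup_inf hMn hB ((sup_comm _ _).trans htop) hBG
    · obtain ⟨a', haM, haB⟩ : ∃ a', a' ∉ M ∧ ∃ b ∈ B, a' = a * b := by
        by_cases h : a ∈ M
        · obtain ⟨b, hb, hbM⟩ := SetLike.not_le_iff_exists.1 hBM
          exact ⟨a * b, fun h1 => hbM ((M.mul_mem_cancel_left h).1 h1), b, hb, rfl⟩
        · exact ⟨a, h, 1, B.one_mem, (mul_one a).symm⟩
      obtain ⟨b, hb, rfl⟩ := haB
      refine ⟨a * b, fun K hK hKab hKle hmem => ?_⟩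
      rcases hK.le_or_le hKab hB hMn hKle with h | h
      · exact ha K hK hKab h ((K.mul_mem_cancel_right (h hb)).1 hmem)
      · exact haM (hM.2 hK.1 h hmem)
  exact ⟨B, a, hB, hBG, fun M hM hab => ⟨hle hM hab, ha M hM hab (hle hM hab)⟩⟩

end NormalSubgroups

section Shift

variable {E S : Type*} [CommGroup E] [Group S]

/-- A twisted translation of `E × S`. -/
def shift (ψ : E →* E) (e : E) (a : S) (x : E × S) : E × S := (e * (x.1 * ψ x.1), a * x.2)

/-- The endomorphism of `E × S` by which `shift` acts on differences. -/
def shiftHom (S : Type*) [Group S] (ψ : E →* E) : E × S →* E × S :=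
  (MonoidHom.id E * ψ).prodMap (MonoidHom.id S)

theorem shift_mul (ψ : E →* E) (e : E) (a : S) (x y : E × S) :
    shift ψ e a (x * y) = shift ψ e a x * shiftHom S ψ y := by
  refine Prod.ext ?_ (mul_assoc _ _ _).symm
  change e * (x.1 * y.1 * ψ (x.1 * y.1)) = e * (x.1 * ψ x.1) * (y.1 * ψ y.1)
  rw [map_mul, mul_mul_mul_comm, mul_assoc e]

theorem normal_map_shiftHom (ψ : E →* E) {M : Subgroup (E × S)} (hM : M.Normal) :
    (M.map (shiftHom S ψ)).Normal := by
  refine ⟨?_⟩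
  rintro - ⟨m, hm, rfl⟩ g
  refine ⟨(1, g.2) * m * (1, g.2)⁻¹, hM.conj_mem m hm _, ?_⟩
  refine Prod.ext ?_ ?_
  · simp [shiftHom]
  · simp [shiftHom]

theorem map_shiftHom_ne_top [Finite E] [Finite S] (ψ : E →* E) {M : Subgroup (E × S)}
    (hM : M ≠ ⊤) : M.map (shiftHom S ψ) ≠ ⊤ := fun h => by
  have hsurj : Function.Surjective (shiftHom S ψ) := fun x => by
    obtain ⟨y, -, hy⟩ := h.ge (Subgroup.mem_top x)
    exact ⟨y, hy⟩
  have hinj := Finite.injective_iff_surjective.2 hsurj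
  exact hM (by rw [← Subgroup.comap_map_eq_self_of_injective hinj M, h, Subgroup.comap_top])

open scoped commutatorElement in
theorem eq_top_of_shift_mem {ψ : E →* E} {e : E}
    (hψ : ∀ W : Subgroup E, (∀ w ∈ W, ψ w ∈ W) → ∀ x, e * ψ x ∈ W → W = ⊤) {a : S}
    (ha : ∀ K : Subgroup S, K.Normal → a ∈ K → K = ⊤) (hS : commutator S = ⊤)
    {M : Subgroup (E × S)} (hM : M.Normal) {c : E × S} (hc : c⁻¹ * shift ψ e a c ∈ M)
    (hMψ : ∀ m ∈ M, shiftHom S ψ m ∈ M) : M = ⊤ := by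
  have h1 : M.map (MonoidHom.snd E S) = ⊤ := by
    have hn : (M.map (MonoidHom.snd E S)).Normal := hM.map _ Prod.snd_surjective
    refine ha _ hn ?_
    have h2 : c.2⁻¹ * (a * c.2) ∈ M.map (MonoidHom.snd E S) := ⟨_, hc, rfl⟩
    simpa [mul_assoc] using hn.conj_mem _ h2 c.2
  have h2 : M.comap (MonoidHom.inr E S) = ⊤ := by
    rw [eq_top_iff, ← hS, commutator_def, Subgroup.commutator_le]
    intro t _ v _
    obtain ⟨⟨w, t⟩, hm, rfl⟩ := h1.ge (Subgroup.mem_top t)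
    have h3 : ⁅((w, t) : E × S), (1, v)⁆ ∈ M := by
      rw [commutatorElement_def, mul_assoc, mul_assoc, ← mul_assoc (1, v)]
      exact M.mul_mem hm (hM.conj_mem _ (M.inv_mem hm) _)
    have h4 : ⁅((w, t) : E × S), (1, v)⁆ = ((1, ⁅t, v⁆) : E × S) := by
      simp [commutatorElement_def]
    rwa [h4] at h3
  have h3 (v : S) : ((1, v) : E × S) ∈ M := h2.ge (Subgroup.mem_top v)
  have h4 : M.comap (MonoidHom.inl E S) = ⊤ := by
    refine hψ _ (fun w hw => ?_) c.1 ?_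
    · have h5 : ((w, 1) : E × S)⁻¹ * shiftHom S ψ (w, 1) ∈ M :=
        M.mul_mem (M.inv_mem hw) (hMψ _ hw)
      have h6 : ((w, 1) : E × S)⁻¹ * shiftHom S ψ (w, 1) = (ψ w, 1) := by
        simp [shiftHom]
      rwa [h6] at h5
    · have h5 := M.mul_mem hc (h3 (c.2⁻¹ * (a * c.2))⁻¹)
      have h6 : c⁻¹ * shift ψ e a c * (1, (c.2⁻¹ * (a * c.2))⁻¹) = (e * ψ c.1, 1) := by
        refine Prod.ext ?_ ?_
        · simp only [shift, Prod.fst_mul, Prod.fst_inv, mul_one]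
          rw [mul_left_comm, inv_mul_cancel_left]
        · exact mul_inv_cancel (c.2⁻¹ * (a * c.2))
      rwa [h6] at h5
  refine (Subgroup.eq_top_iff' M).2 fun x => ?_
  have h5 : x = (x.1, 1) * (1, x.2) := by simp
  rw [h5]
  exact M.mul_mem (h4.ge (Subgroup.mem_top x.1)) (h3 x.2)

end Shift

section CosetPoset

instance {G : Type} [Group G] [Finite G] {F : Set (Subgroup G)} : Finite (CosetPoset G F) :=
  inferInstanceAs (Finite {X : Set G // ∃ H ∈ F, ∃ g : G, X = g • (H : Set G)})

variable {G E S : Type} [Group G] [CommGroup E] [Group S]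

theorem preimage_shift_image_smul (f : G →* E × S) (ψ : E →* E) (e : E) (a : S)
    (N : Subgroup G) {g d : G} (hd : f d = shift ψ e a (f g)) :
    f ⁻¹' (shift ψ e a '' (f '' (g • (N : Set G)))) =
      d • (((N.map f).map (shiftHom S ψ)).comap f : Set G) := by
  ext y
  rw [Set.mem_smul_set_iff_inv_smul_mem, smul_eq_mul]
  constructor
  · rintro ⟨-, ⟨-, ⟨n, hn, rfl⟩, rfl⟩, hy⟩
    refine ⟨f n, ⟨n, hn, rfl⟩, ?_⟩
    rw [map_mul, map_inv, hd, eq_inv_mul_iff_mul_eq, ← shift_mul, ← hy]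
    exact congrArg _ (map_mul f g n).symm
  · rintro ⟨-, ⟨n, hn, rfl⟩, hy⟩
    refine ⟨f (g * n), ⟨g * n, ⟨n, hn, rfl⟩, rfl⟩, ?_⟩
    rw [map_mul, shift_mul, hy, map_mul, map_inv, hd, mul_inv_cancel_left]

theorem exists_monotone_ne_of_surjective [Finite E] [Finite S] {f : G →* E × S}
    (hf : Function.Surjective f) (hf' : ∀ N : Subgroup G, N.Normal → N.map f = ⊤ → N = ⊤)
    {ψ : E →* E} {e : E}
    (hψ : ∀ W : Subgroup E, (∀ w ∈ W, ψ w ∈ W) → ∀ x, e * ψ x ∈ W → W = ⊤) {a : S}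
    (ha : ∀ K : Subgroup S, K.Normal → a ∈ K → K = ⊤) (hS : commutator S = ⊤) :
    ∃ T : CosetPoset G {N : Subgroup G | N.Normal ∧ N ≠ ⊤} →o
      CosetPoset G {N : Subgroup G | N.Normal ∧ N ≠ ⊤}, ∀ p, T p ≠ p := by
  refine ⟨⟨fun X => ⟨f ⁻¹' (shift ψ e a '' (f '' X.1)), ?_⟩, fun X Y hXY =>
    Set.preimage_mono (Set.image_mono (Set.image_mono hXY))⟩, ?_⟩
  · obtain ⟨-, N, ⟨hN, hne⟩, g, rfl⟩ := X
    obtain ⟨d, hd⟩ := hf (shift ψ e a (f g))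
    have hn := normal_map_shiftHom ψ (hN.map f hf)
    refine ⟨_, ⟨hn.comap f, fun h => ?_⟩, d, preimage_shift_image_smul f ψ e a N hd⟩
    refine map_shiftHom_ne_top ψ (fun h1 => hne (hf' N hN h1)) ?_
    rw [← Subgroup.map_comap_eq_self_of_surjective hf (Subgroup.map _ _), h,
      Subgroup.map_top_of_surjective f hf]
  · rintro ⟨-, N, ⟨hN, hne⟩, g, rfl⟩ hfix
    have h1 : f ⁻¹' (shift ψ e a '' (f '' (g • (N : Set G)))) = g • (N : Set G) :=
      congrArg Subtype.val hfix
    have h2 : ∀ n ∈ N, (f g)⁻¹ * shift ψ e a (f (g * n)) ∈ N.map f := fun n hn => by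
      obtain ⟨y, hy⟩ := hf (shift ψ e a (f (g * n)))
      have h3 : y ∈ g • (N : Set G) := by
        rw [← h1]
        exact ⟨_, ⟨_, ⟨n, hn, rfl⟩, rfl⟩, hy.symm⟩
      obtain ⟨m, hm, rfl⟩ := h3
      refine ⟨m, hm, ?_⟩
      rw [← hy, eq_inv_mul_iff_mul_eq]
      exact (map_mul f g m).symm
    have h3 : (f g)⁻¹ * shift ψ e a (f g) ∈ N.map f := by
      simpa using h2 1 N.one_mem
    refine hne (hf' N hN (eq_top_of_shift_mem hψ ha hS (hN.map f hf) h3 ?_))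
    rintro - ⟨n, hn, rfl⟩
    have h4 := h2 n hn
    rw [map_mul, shift_mul, ← mul_assoc] at h4
    exact ((N.map f).mul_mem_cancel_left h3).1 h4

theorem exists_monotone_ne_cosetPoset (G : Type) [Group G] [Finite G] :
    ∃ T : CosetPoset G {N : Subgroup G | N.Normal ∧ N ≠ ⊤} →o
      CosetPoset G {N : Subgroup G | N.Normal ∧ N ≠ ⊤}, ∀ p, T p ≠ p := by
  obtain ⟨B, a, hB, hBG, hmax⟩ := exists_normal_sup_commutator_eq_top G
  obtain ⟨ψ, e, hψ⟩ := exists_end_mul (Abelianization G)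
  have htop (K : Subgroup G) (hK : K.Normal) (hKB : K ⊔ B = ⊤)
      (hKG : K ⊔ commutator G = ⊤) : K = ⊤ := by
    by_contra hne
    obtain ⟨M, hKM, hM⟩ := exists_le_isMaximalNormal hK hne
    by_cases hGM : commutator G ≤ M
    · exact hM.1.2 (top_le_iff.1 (hKG ▸ sup_le hKM hGM))
    · exact hM.1.2 (top_le_iff.1 (hKB ▸ sup_le hKM (hmax M hM hGM).1))
  have hmk : Function.Surjective (QuotientGroup.mk' B) := QuotientGroup.mk'_surjective B
  have hof : Function.Surjective (Abelianization.of (G := G)) := QuotientGroup.mk'_surjective _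
  have hkerab : (Abelianization.of (G := G)).ker = commutator G := Abelianization.ker_of G
  have hsup (K : Subgroup G) {H : Type} [Group H] (q : G →* H)
      (hq : K.map q = ⊤) : K ⊔ q.ker = ⊤ := by
    rw [← Subgroup.comap_map_eq, hq, Subgroup.comap_top]
  let f : G →* Abelianization G × (G ⧸ B) := Abelianization.of.prod (QuotientGroup.mk' B)
  refine exists_monotone_ne_of_surjective (f := f) ?_ (fun N hN hNf => htop N hN ?_ ?_) hψ
    (a := QuotientGroup.mk' B a) (fun K hK haK => ?_) ?_
  · rintro ⟨x, y⟩
    obtain ⟨g, rfl⟩ := hof x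
    obtain ⟨h, rfl⟩ := hmk y
    obtain ⟨b, hb, c, hc, hbc⟩ := Subgroup.mem_sup_of_normal_right.1
      (hBG.ge (Subgroup.mem_top (g * h⁻¹)))
    have hc1 : Abelianization.of c = 1 := by rwa [← MonoidHom.mem_ker, hkerab]
    have hb1 : QuotientGroup.mk' B b = 1 := (QuotientGroup.eq_one_iff b).2 hb
    refine ⟨b * h, Prod.ext ?_ ?_⟩
    · change Abelianization.of (b * h) = Abelianization.of g
      rw [mul_inv_eq_iff_eq_mul.1 hbc.symm]
      simp [hc1]
    · change QuotientGroup.mk' B (b * h) = QuotientGroup.mk' B h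
      rw [map_mul, hb1, one_mul]
  · rw [← QuotientGroup.ker_mk' B]
    refine hsup N _ ?_
    have h1 : (N.map f).map (MonoidHom.snd _ _) = N.map (QuotientGroup.mk' B) := by
      rw [Subgroup.map_map]
      rfl
    rw [← h1, hNf, Subgroup.map_top_of_surjective _ Prod.snd_surjective]
  · rw [← hkerab]
    refine hsup N _ ?_
    have h1 : (N.map f).map (MonoidHom.fst _ _) = N.map Abelianization.of := by
      rw [Subgroup.map_map]
      rfl
    rw [← h1, hNf, Subgroup.map_top_of_surjective _ Prod.fst_surjective]
  · by_contra hne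
    have hne' : K.comap (QuotientGroup.mk' B) ≠ ⊤ := fun h => hne (by
      rw [← Subgroup.map_comap_eq_self_of_surjective hmk K, h,
        Subgroup.map_top_of_surjective _ hmk])
    obtain ⟨M, hKM, hM⟩ := exists_le_isMaximalNormal (hK.comap _) hne'
    have hBM : B ≤ M := fun b hb => hKM (by
      have hb1 : QuotientGroup.mk' B b = 1 := (QuotientGroup.eq_one_iff b).2 hb
      rw [Subgroup.mem_comap, hb1]
      exact K.one_mem)
    by_cases hGM : commutator G ≤ M
    · exact hM.1.2 (top_le_iff.1 (hBG ▸ sup_le hBM hGM))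
    · exact (hmax M hM hGM).2 (hKM haK)
  · have h1 : B.map (QuotientGroup.mk' B) = ⊥ := by
      rw [Subgroup.map_eq_bot_iff, QuotientGroup.ker_mk']
    have h2 := congrArg (Subgroup.map (QuotientGroup.mk' B)) hBG
    rw [Subgroup.map_sup, h1, bot_sup_eq, Subgroup.map_top_of_surjective _ hmk, commutator_def,
      Subgroup.map_commutator, Subgroup.map_top_of_surjective _ hmk] at h2
    exact h2

end CosetPoset

/-- **Theorem (Bux–Welsch).** If `G` is a finite nontrivial group, the geometric
realization of the nerve of the coset poset of the family of proper normal subgroups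
of `G` is not contractible. -/
theorem statement4 (G : Type) [Group G] [Finite G] [Nontrivial G] :
    ¬ ContractibleSpace (cosetNerveRealization G {N : Subgroup G | N.Normal ∧ N ≠ ⊤}) := by
  intro h
  have : ContractibleSpace (SSet.toTop.obj (CategoryTheory.nerve
    (CosetPoset G {N : Subgroup G | N.Normal ∧ N ≠ ⊤}))) := h
  obtain ⟨T, hT⟩ := exists_monotone_ne_cosetPoset G
  obtain ⟨p, hp⟩ := exists_fixed_of_contractibleSpace_nerve _ T
  exact hT p hp
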